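/- arXiv:2206.05632 — 3 statements merged into one kernel-verified Lean document; each statement's English description precedes it below -/
import Mathlib

section
/- Let A and B be n×n positive semidefinite complex matrices, X an arbitrary n×n complex matrix, and let s, t be real numbers in [0,1] with |1 − 2t| < |1 − 2s| and with 1 − 2t and 1 − 2s of the same sign. Then ‖A^{1−t}XB^t − A^tXB^{1−t}‖ ≤ |(1−2t)/(1−2s)| · ‖A^{1−s}XB^s − A^sXB^{1−s}‖, where ‖·‖ denotes the operator norm induced by the Euclidean norm on ℂⁿ. (Theorem 2.5, instance for the operator norm) -/
open scoped ComplexOrder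

/-- Matrix power of a positive semidefinite matrix via the continuous functional calculus
(equivalently, raising each eigenvalue to the power `v` in a spectral decomposition). -/
noncomputable def mpow {n : ℕ} (A : Matrix (Fin n) (Fin n) ℂ) (v : ℝ) :
    Matrix (Fin n) (Fin n) ℂ :=
  cfc (fun x : ℝ => x ^ v) A

/-- The Frobenius norm of a complex matrix. -/
noncomputable def frobNorm {n : ℕ} (M : Matrix (Fin n) (Fin n) ℂ) : ℝ :=
  Real.sqrt (∑ i, ∑ j, ‖M i j‖ ^ 2)

/-- The operator norm of a complex matrix induced by the Euclidean norm on `ℂⁿ`. -/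
noncomputable def l2OpNorm {n : ℕ} (M : Matrix (Fin n) (Fin n) ℂ) : ℝ :=
  ‖Matrix.toEuclideanCLM (𝕜 := ℂ) M‖

open Filter Topology

/-- Perturbing an operator `Y` on a finite-dimensional space by `i (H Y - Y K)`, with `H` and `K`
self-adjoint, does not decrease its norm. -/
lemma norm_le_norm_add_I_smul_commutator {E : Type*} [NormedAddCommGroup E]
    [InnerProductSpace ℂ E] [FiniteDimensional ℂ E] (H K Y : E →L[ℂ] E)
    (hH : IsSelfAdjoint H) (hK : IsSelfAdjoint K) :
    ‖Y‖ ≤ ‖Y + Complex.I • (H * Y - Y * K)‖ := by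
  set M := Y + Complex.I • (H * Y - Y * K)
  rcases subsingleton_or_nontrivial E with hE | hE
  · simp [Subsingleton.elim Y 0]
  have : ProperSpace E := FiniteDimensional.proper ℂ E
  obtain ⟨v, hv, hmax⟩ := (isCompact_sphere (0 : E) 1).exists_isMaxOn
    (Set.nonempty_coe_sort.1 (NormedSpace.sphere_nonempty_rclike ℂ zero_le_one))
    (f := fun v => ‖Y v‖) (by fun_prop)
  have hv1 : ‖v‖ = 1 := by simpa using hv
  have hYv : ‖Y v‖ = ‖Y‖ := by
    refine le_antisymm (by simpa [hv1] using Y.le_opNorm v) ?_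
    exact ContinuousLinearMap.opNorm_le_of_unit_norm (norm_nonneg _) fun x hx =>
      hmax (mem_sphere_zero_iff_norm.2 hx)
  have heig : (ContinuousLinearMap.adjoint Y) (Y v) = ((‖Y‖ ^ 2 : ℝ) : ℂ) • v := by
    rw [← sub_eq_zero, ← norm_eq_zero, ← sq_eq_zero_iff]
    refine le_antisymm ?_ (sq_nonneg _)
    have h1 : ‖(ContinuousLinearMap.adjoint Y) (Y v)‖ ≤ ‖Y‖ * ‖Y‖ := by
      have := (ContinuousLinearMap.adjoint Y).le_opNorm (Y v)
      rwa [LinearIsometryEquiv.norm_map, hYv] at this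
    have h2 : ‖(ContinuousLinearMap.adjoint Y) (Y v)‖ ^ 2 ≤ (‖Y‖ * ‖Y‖) ^ 2 := by gcongr
    rw [@norm_sub_sq ℂ, inner_smul_right, ContinuousLinearMap.adjoint_inner_left,
      inner_self_eq_norm_sq_to_K, hYv, norm_smul, hv1]
    have h3 : RCLike.re (((‖Y‖ ^ 2 : ℝ) : ℂ) * ((‖Y‖ : ℝ) : ℂ) ^ 2) = ‖Y‖ ^ 4 := by
      rw [← Complex.ofReal_pow, ← Complex.ofReal_mul]
      simp only [RCLike.re_to_complex, Complex.ofReal_re]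
      ring
    have h4 : ‖((‖Y‖ ^ 2 : ℝ) : ℂ)‖ = ‖Y‖ ^ 2 := by simp
    erw [h3]
    rw [h4]
    nlinarith
  have hHim : (inner ℂ (Y v) (H (Y v))).im = 0 :=
    hH.isSymmetric.im_inner_self_apply (Y v)
  have hKim : (inner ℂ v (K v)).im = 0 :=
    hK.isSymmetric.im_inner_self_apply v
  have hre : (inner ℂ (Y v) (M v)).re = ‖Y‖ ^ 2 := by
    have h1 : inner ℂ (Y v) (Y (K v)) = ((‖Y‖ ^ 2 : ℝ) : ℂ) * inner ℂ v (K v) := by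
      rw [← ContinuousLinearMap.adjoint_inner_left, heig, inner_smul_left, Complex.conj_ofReal]
    have h2 : (inner ℂ (Y v) (Y v)).re = ‖Y‖ ^ 2 := by
      rw [← hYv]
      exact inner_self_eq_norm_sq (𝕜 := ℂ) (Y v)
    have h3 : M v = Y v + Complex.I • (H (Y v) - Y (K v)) := rfl
    rw [h3, inner_add_right, inner_smul_right, inner_sub_right, h1, Complex.add_re, h2]
    simp only [Complex.mul_re, Complex.I_re, Complex.I_im, Complex.sub_im, Complex.im_ofReal_mul,
      hHim, hKim]
    ring
  have hle : ‖Y‖ ^ 2 ≤ ‖Y‖ * ‖M‖ := by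
    rw [← hre]
    calc _ ≤ ‖Y v‖ * ‖M v‖ := re_inner_le_norm (𝕜 := ℂ) _ _
      _ ≤ ‖Y‖ * ‖M‖ := by
        rw [hYv]
        gcongr
        simpa [hv1] using M.le_opNorm v
  rcases (norm_nonneg Y).eq_or_lt with h0 | h0
  · rw [← h0]
    exact norm_nonneg M
  · exact le_of_mul_le_mul_left (by rwa [← sq]) h0

section SchurMultipliers

variable {n : ℕ}

local notation "Mat" => Matrix (Fin n) (Fin n) ℂ

/-- The Schur product of `Y` with the real array `c`. -/
noncomputable def schurMul (c : Fin n → Fin n → ℝ) (Y : Mat) : Mat :=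
  Matrix.of fun i j => (c i j : ℂ) * Y i j

lemma schurMul_schurMul (c d : Fin n → Fin n → ℝ) (Y : Mat) :
    schurMul c (schurMul d Y) = schurMul (fun i j => c i j * d i j) Y := by
  ext i j
  simp [schurMul, mul_assoc]

lemma l2OpNorm_add_le (Y Z : Mat) : l2OpNorm (Y + Z) ≤ l2OpNorm Y + l2OpNorm Z := by
  simpa only [l2OpNorm, map_add] using norm_add_le _ _

lemma l2OpNorm_neg (Y : Mat) : l2OpNorm (-Y) = l2OpNorm Y := by
  simp only [l2OpNorm, map_neg, norm_neg]

lemma l2OpNorm_smul (r : ℂ) (Y : Mat) : l2OpNorm (r • Y) = ‖r‖ * l2OpNorm Y := by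
  simp only [l2OpNorm, map_smul, norm_smul]

lemma continuous_l2OpNorm : Continuous (l2OpNorm : Mat → ℝ) :=
  continuous_norm.comp (LinearMap.continuous_of_finiteDimensional
    (Matrix.toEuclideanCLM (𝕜 := ℂ) (n := Fin n)).toAlgEquiv.toLinearMap)

lemma l2OpNorm_unitary_mul_mul_star (U V : unitary Mat) (Y : Mat) :
    l2OpNorm ((U : Mat) * Y * (star V : Mat)) = l2OpNorm Y := by
  simp only [l2OpNorm, map_mul]
  rw [CStarRing.norm_mul_mem_unitary, CStarRing.norm_mem_unitary_mul]
  · exact Unitary.map_mem _ U.2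
  · exact Unitary.map_mem _ (Unitary.star_mem V.2)

lemma tendsto_l2OpNorm_schurMul {ι : Type*} {l : Filter ι} {c : ι → Fin n → Fin n → ℝ}
    {d : Fin n → Fin n → ℝ} (h : ∀ i j, Tendsto (fun x => c x i j) l (𝓝 (d i j))) (Y : Mat) :
    Tendsto (fun x => l2OpNorm (schurMul (c x) Y)) l (𝓝 (l2OpNorm (schurMul d Y))) := by
  refine (continuous_l2OpNorm.tendsto _).comp ?_
  refine tendsto_pi_nhds.2 fun i => tendsto_pi_nhds.2 fun j => ?_
  exact ((Complex.continuous_ofReal.tendsto _).comp (h i j)).mul_const (Y i j)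

lemma l2OpNorm_le_one_add_I_mul (h k : Fin n → ℝ) (Y : Mat) :
    l2OpNorm Y ≤
      l2OpNorm (Matrix.of fun i j => (1 + Complex.I * ((h i - k j : ℝ) : ℂ)) * Y i j) := by
  have hsa (d : Fin n → ℝ) :
      IsSelfAdjoint (Matrix.toEuclideanCLM (𝕜 := ℂ) (Matrix.diagonal fun i => (d i : ℂ))) := by
    refine IsSelfAdjoint.map ?_ _
    rw [isSelfAdjoint_iff, Matrix.star_eq_conjTranspose, Matrix.diagonal_conjTranspose]
    congr 1
    ext i
    simp
  refine (norm_le_norm_add_I_smul_commutator _ _ _ (hsa h) (hsa k)).trans_eq ?_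
  rw [← map_mul, ← map_mul, ← map_sub, ← map_smul, ← map_add, l2OpNorm]
  congr 2
  ext i j
  simp only [Matrix.add_apply, Matrix.smul_apply, Matrix.sub_apply, Matrix.diagonal_mul,
    Matrix.mul_diagonal, Matrix.of_apply, smul_eq_mul]
  push_cast
  ring

lemma l2OpNorm_le_one_add_sq (h k : Fin n → ℝ) (Y : Mat) :
    l2OpNorm Y ≤ l2OpNorm (schurMul (fun i j => 1 + (h i - k j) ^ 2) Y) := by
  refine (l2OpNorm_le_one_add_I_mul h k Y).trans
    ((l2OpNorm_le_one_add_I_mul (-h) (-k) _).trans_eq ?_)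
  congr 1
  ext i j
  simp only [schurMul, Matrix.of_apply, Pi.neg_apply]
  push_cast
  linear_combination (-((h i : ℂ) - k j) ^ 2 * Y i j) * Complex.I_sq

lemma l2OpNorm_one_add_sq_mono (h k : Fin n → ℝ) {α β : ℝ} (hα : 0 ≤ α) (hαβ : α ≤ β) (Y : Mat) :
    l2OpNorm (schurMul (fun i j => 1 + (α * (h i - k j)) ^ 2) Y) ≤
      l2OpNorm (schurMul (fun i j => 1 + (β * (h i - k j)) ^ 2) Y) := by
  rcases (hα.trans hαβ).eq_or_lt with h0 | hβ
  · rw [show α = β by linarith]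
  set Z := schurMul (fun i j => 1 + (β * (h i - k j)) ^ 2) Y with hZ
  set r := (α / β) ^ 2 with hr
  have hr0 : 0 ≤ r := sq_nonneg _
  have hr1 : r ≤ 1 := pow_le_one₀ (by positivity) (by rwa [div_le_one hβ])
  have hYZ : l2OpNorm Y ≤ l2OpNorm Z := by
    simpa only [← mul_sub] using l2OpNorm_le_one_add_sq (fun i => β * h i) (fun j => β * k j) Y
  have hsplit : schurMul (fun i j => 1 + (α * (h i - k j)) ^ 2) Y =
      ((1 - r : ℝ) : ℂ) • Y + (r : ℂ) • Z := by
    have hrβ : r * β ^ 2 = α ^ 2 := by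
      rw [hr]
      field_simp
    ext i j
    simp only [hZ, schurMul, Matrix.of_apply, Matrix.add_apply, Matrix.smul_apply, smul_eq_mul]
    rw [mul_pow, mul_pow, ← hrβ]
    push_cast
    ring
  rw [hsplit]
  refine (l2OpNorm_add_le _ _).trans ?_
  rw [l2OpNorm_smul, l2OpNorm_smul, Complex.norm_of_nonneg hr0,
    Complex.norm_of_nonneg (sub_nonneg.2 hr1)]
  nlinarith

lemma l2OpNorm_prod_one_add_sq_mono (h k : Fin n → ℝ) {α β : ℝ} (hα : 0 ≤ α) (hαβ : α ≤ β)
    (N : ℕ) (Y : Mat) :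
    l2OpNorm (schurMul
      (fun i j => ∏ m ∈ Finset.range N, (1 + (α / (m + 1) * (h i - k j)) ^ 2)) Y) ≤
    l2OpNorm (schurMul
      (fun i j => ∏ m ∈ Finset.range N, (1 + (β / (m + 1) * (h i - k j)) ^ 2)) Y) := by
  induction N generalizing Y with
  | zero => simp
  | succ N ih =>
    simp only [Finset.prod_range_succ]
    calc _ = l2OpNorm (schurMul (fun i j => 1 + (α / (N + 1) * (h i - k j)) ^ 2)
            (schurMul (fun i j =>
              ∏ m ∈ Finset.range N, (1 + (α / (m + 1) * (h i - k j)) ^ 2)) Y)) := by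
          simp only [schurMul_schurMul, mul_comm]
      _ ≤ l2OpNorm (schurMul (fun i j => 1 + (β / (N + 1) * (h i - k j)) ^ 2)
            (schurMul (fun i j =>
              ∏ m ∈ Finset.range N, (1 + (α / (m + 1) * (h i - k j)) ^ 2)) Y)) :=
          l2OpNorm_one_add_sq_mono h k (by positivity) (by gcongr) _
      _ = l2OpNorm (schurMul (fun i j =>
              ∏ m ∈ Finset.range N, (1 + (α / (m + 1) * (h i - k j)) ^ 2))
            (schurMul (fun i j => 1 + (β / (N + 1) * (h i - k j)) ^ 2) Y)) := by
          simp only [schurMul_schurMul, mul_comm]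
      _ ≤ _ := ih _
      _ = _ := by simp only [schurMul_schurMul]

/-- Euler's product formula for the real hyperbolic sine. -/
lemma tendsto_euler_sinh_prod (x : ℝ) :
    Tendsto (fun N : ℕ => Real.pi * x * ∏ m ∈ Finset.range N, (1 + (x / (m + 1)) ^ 2)) atTop
      (𝓝 (Real.sinh (Real.pi * x))) := by
  have h := (Complex.continuous_im.tendsto _).comp
    (Complex.tendsto_euler_sin_prod (x * Complex.I))
  rw [← mul_assoc, Complex.sin_mul_I, ← Complex.ofReal_mul, ← Complex.ofReal_sinh,
    Complex.im_ofReal_mul, Complex.I_im, mul_one] at h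
  refine h.congr fun N => ?_
  have hprod : ∏ m ∈ Finset.range N, (1 - ((x : ℂ) * Complex.I) ^ 2 / ((m : ℂ) + 1) ^ 2) =
      ((∏ m ∈ Finset.range N, (1 + (x / (m + 1)) ^ 2) : ℝ) : ℂ) := by
    push_cast
    refine Finset.prod_congr rfl fun m _ => ?_
    rw [mul_pow, Complex.I_sq, div_pow]
    ring
  rw [Function.comp_apply, hprod, mul_right_comm, ← Complex.ofReal_mul, Complex.im_ofReal_mul, Complex.I_im, mul_one]

lemma l2OpNorm_sinh_mono (h k : Fin n → ℝ) {α β : ℝ} (hα : 0 ≤ α) (hαβ : α ≤ β) (Y : Mat) :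
    β * l2OpNorm (schurMul (fun i j => Real.sinh (Real.pi * (α * (h i - k j)))) Y) ≤
      α * l2OpNorm (schurMul (fun i j => Real.sinh (Real.pi * (β * (h i - k j)))) Y) := by
  have hlim (γ : ℝ) := tendsto_l2OpNorm_schurMul
    (fun i j => tendsto_euler_sinh_prod (γ * (h i - k j))) Y
  refine le_of_tendsto_of_tendsto' ((hlim α).const_mul β) ((hlim β).const_mul α) fun N => ?_
  have hfactor {γ : ℝ} (hγ : 0 ≤ γ) :
      l2OpNorm (schurMul (fun i j => Real.pi * (γ * (h i - k j)) *
        ∏ m ∈ Finset.range N, (1 + (γ * (h i - k j) / (m + 1)) ^ 2)) Y) =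
      γ * l2OpNorm (schurMul
        (fun i j => ∏ m ∈ Finset.range N, (1 + (γ / (m + 1) * (h i - k j)) ^ 2))
        (schurMul (fun i j => Real.pi * (h i - k j)) Y)) := by
    rw [schurMul_schurMul]
    nth_rw 3 [← Complex.norm_of_nonneg hγ]
    rw [← l2OpNorm_smul]
    congr 1
    ext i j
    simp only [schurMul, Matrix.of_apply, Matrix.smul_apply, smul_eq_mul, ← mul_assoc,
      ← Complex.ofReal_mul, mul_div_right_comm]
    congr 2
    ring
  rw [hfactor hα, hfactor (hα.trans hαβ), mul_left_comm]
  gcongr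
  · exact hα.trans hαβ
  · exact l2OpNorm_prod_one_add_sq_mono h k hα hαβ N _

/-- The scalar kernel `a ^ (1 - t) * b ^ t - a ^ t * b ^ (1 - t)` of the Heinz difference. -/
noncomputable def heinzKernel (a b : Fin n → ℝ) (t : ℝ) (i j : Fin n) : ℝ :=
  a i ^ (1 - t) * b j ^ t - a i ^ t * b j ^ (1 - t)

lemma heinzKernel_eq_sinh {a b : Fin n → ℝ} (ha : ∀ i, 0 < a i) (hb : ∀ j, 0 < b j) (t : ℝ)
    (i j : Fin n) :
    heinzKernel a b t i j =
      Real.sinh (Real.pi * ((1 - 2 * t) *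
        (Real.log (a i) / (2 * Real.pi) - Real.log (b j) / (2 * Real.pi)))) *
      (2 * Real.exp ((Real.log (a i) + Real.log (b j)) / 2)) := by
  have hpi := Real.pi_ne_zero
  rw [heinzKernel, Real.sinh_eq]
  simp only [Real.rpow_def_of_pos (ha i), Real.rpow_def_of_pos (hb j), ← Real.exp_add]
  rw [← mul_assoc, div_mul_cancel₀ _ two_ne_zero, sub_mul, ← Real.exp_add, ← Real.exp_add]
  congr 2 <;> field_simp <;> ring

lemma l2OpNorm_heinzKernel_le_of_pos {a b : Fin n → ℝ} (ha : ∀ i, 0 < a i) (hb : ∀ j, 0 < b j)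
    {s t : ℝ} (hst : s ≤ t) (ht : t ≤ 1 / 2) (Y : Mat) :
    (1 - 2 * s) * l2OpNorm (schurMul (heinzKernel a b t) Y) ≤
      (1 - 2 * t) * l2OpNorm (schurMul (heinzKernel a b s) Y) := by
  have hfactor (u : ℝ) := (schurMul_schurMul (fun i j => Real.sinh (Real.pi * ((1 - 2 * u) *
      (Real.log (a i) / (2 * Real.pi) - Real.log (b j) / (2 * Real.pi)))))
      (fun i j => 2 * Real.exp ((Real.log (a i) + Real.log (b j)) / 2)) Y)
  simp only [← heinzKernel_eq_sinh ha hb] at hfactor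
  have h := l2OpNorm_sinh_mono (fun i => Real.log (a i) / (2 * Real.pi))
    (fun j => Real.log (b j) / (2 * Real.pi)) (α := 1 - 2 * t) (β := 1 - 2 * s)
    (by linarith) (by linarith)
    (schurMul (fun i j => 2 * Real.exp ((Real.log (a i) + Real.log (b j)) / 2)) Y)
  rwa [hfactor, hfactor] at h

lemma l2OpNorm_heinzKernel_le {a b : Fin n → ℝ} (ha : ∀ i, 0 ≤ a i) (hb : ∀ j, 0 ≤ b j)
    {s t : ℝ} (hs : 0 ≤ s) (hst : s ≤ t) (ht : t ≤ 1 / 2) (Y : Mat) :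
    (1 - 2 * s) * l2OpNorm (schurMul (heinzKernel a b t) Y) ≤
      (1 - 2 * t) * l2OpNorm (schurMul (heinzKernel a b s) Y) := by
  have hlim {u : ℝ} (hu0 : 0 ≤ u) (hu1 : u ≤ 1 / 2) :
      Tendsto (fun ε : ℝ => l2OpNorm (schurMul
        (heinzKernel (fun i => a i + ε) (fun j => b j + ε) u) Y)) (𝓝[>] 0)
        (𝓝 (l2OpNorm (schurMul (heinzKernel a b u) Y))) := by
    refine tendsto_l2OpNorm_schurMul (fun i j => ?_) Y
    have hpow {v : ℝ} (hv : 0 ≤ v) (x : ℝ) :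
        Tendsto (fun ε : ℝ => (x + ε) ^ v) (𝓝[>] 0) (𝓝 (x ^ v)) := by
      have hc : Continuous fun ε : ℝ => (x + ε) ^ v :=
        (Real.continuous_rpow_const hv).comp (continuous_const_add x)
      simpa using (hc.tendsto 0).mono_left nhdsWithin_le_nhds
    exact ((hpow (by linarith) _).mul (hpow hu0 _)).sub
      ((hpow hu0 _).mul (hpow (by linarith) _))
  refine le_of_tendsto_of_tendsto ((hlim (hs.trans hst) ht).const_mul _)
    ((hlim hs (hst.trans ht)).const_mul _) ?_
  filter_upwards [self_mem_nhdsWithin] with ε hε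
  exact l2OpNorm_heinzKernel_le_of_pos (fun i => add_pos_of_nonneg_of_pos (ha i) hε)
    (fun j => add_pos_of_nonneg_of_pos (hb j) hε) hst ht Y

lemma mpow_eq {A : Mat} (hA : A.IsHermitian) (v : ℝ) :
    mpow A v = (hA.eigenvectorUnitary : Mat) *
      Matrix.diagonal (fun i => ((hA.eigenvalues i ^ v : ℝ) : ℂ)) *
      (star hA.eigenvectorUnitary : Mat) := by
  rw [mpow, hA.cfc_eq]
  rfl

lemma heinz_diff_eq {A B : Mat} (hA : A.IsHermitian) (hB : B.IsHermitian) (X : Mat) (t : ℝ) :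
    mpow A (1 - t) * X * mpow B t - mpow A t * X * mpow B (1 - t) =
      (hA.eigenvectorUnitary : Mat) *
        schurMul (heinzKernel hA.eigenvalues hB.eigenvalues t)
          ((star hA.eigenvectorUnitary : Mat) * X * (hB.eigenvectorUnitary : Mat)) *
        (star hB.eigenvectorUnitary : Mat) := by
  have hschur : schurMul (heinzKernel hA.eigenvalues hB.eigenvalues t)
      ((star hA.eigenvectorUnitary : Mat) * X * (hB.eigenvectorUnitary : Mat)) =
      Matrix.diagonal (fun i => ((hA.eigenvalues i ^ (1 - t) : ℝ) : ℂ)) *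
        ((star hA.eigenvectorUnitary : Mat) * X * (hB.eigenvectorUnitary : Mat)) *
        Matrix.diagonal (fun i => ((hB.eigenvalues i ^ t : ℝ) : ℂ)) -
      Matrix.diagonal (fun i => ((hA.eigenvalues i ^ t : ℝ) : ℂ)) *
        ((star hA.eigenvectorUnitary : Mat) * X * (hB.eigenvectorUnitary : Mat)) *
        Matrix.diagonal (fun i => ((hB.eigenvalues i ^ (1 - t) : ℝ) : ℂ)) := by
    ext i j
    rw [Matrix.sub_apply, Matrix.mul_diagonal, Matrix.mul_diagonal, Matrix.diagonal_mul,
      Matrix.diagonal_mul]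
    simp only [schurMul, heinzKernel, Matrix.of_apply]
    push_cast
    ring
  rw [hschur]
  simp only [mpow_eq hA, mpow_eq hB, mul_sub, sub_mul, mul_assoc]

lemma l2OpNorm_heinz_diff_le {A B : Mat} (hA : A.PosSemidef) (hB : B.PosSemidef) (X : Mat)
    {s t : ℝ} (hs : 0 ≤ s) (hst : s ≤ t) (ht : t ≤ 1 / 2) :
    (1 - 2 * s) * l2OpNorm (mpow A (1 - t) * X * mpow B t - mpow A t * X * mpow B (1 - t)) ≤
      (1 - 2 * t) *
        l2OpNorm (mpow A (1 - s) * X * mpow B s - mpow A s * X * mpow B (1 - s)) := by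
  rw [heinz_diff_eq hA.1 hB.1, heinz_diff_eq hA.1 hB.1, l2OpNorm_unitary_mul_mul_star,
    l2OpNorm_unitary_mul_mul_star]
  exact l2OpNorm_heinzKernel_le hA.eigenvalues_nonneg hB.eigenvalues_nonneg hs hst ht _

end SchurMultipliers

/-- Theorem 2.5 for the operator norm. -/
theorem heinz_diff_opNorm (n : ℕ) (A B X : Matrix (Fin n) (Fin n) ℂ)
    (hA : A.PosSemidef) (hB : B.PosSemidef) (s t : ℝ)
    (hs0 : 0 ≤ s) (hs1 : s ≤ 1) (ht0 : 0 ≤ t) (ht1 : t ≤ 1)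
    (hts : |1 - 2 * t| < |1 - 2 * s|) (hsign : 0 < (1 - 2 * t) * (1 - 2 * s)) :
    l2OpNorm (mpow A (1 - t) * X * mpow B t - mpow A t * X * mpow B (1 - t)) ≤
      |(1 - 2 * t) / (1 - 2 * s)| *
        l2OpNorm (mpow A (1 - s) * X * mpow B s - mpow A s * X * mpow B (1 - s)) := by
  rcases pos_and_pos_or_neg_and_neg_of_mul_pos hsign with ⟨ht, hs⟩ | ⟨ht, hs⟩
  · rw [abs_of_pos ht, abs_of_pos hs] at hts
    rw [abs_of_pos (div_pos ht hs), div_mul_eq_mul_div, le_div_iff₀' hs]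
    exact l2OpNorm_heinz_diff_le hA hB X hs0 (by linarith) (by linarith)
  · rw [abs_of_neg ht, abs_of_neg hs] at hts
    rw [abs_of_pos (div_pos_of_neg_of_neg ht hs), ← neg_div_neg_eq, div_mul_eq_mul_div,
      le_div_iff₀' (neg_pos.2 hs)]
    have h := l2OpNorm_heinz_diff_le hA hB X (s := 1 - s) (t := 1 - t)
      (by linarith) (by linarith) (by linarith)
    rw [sub_sub_cancel, sub_sub_cancel, ← l2OpNorm_neg, neg_sub,
      ← l2OpNorm_neg (mpow A s * _ * _ - _), neg_sub] at h
    convert! h using 2 <;> ring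
end

section
/- Let A and B be n×n positive semidefinite complex matrices, X an arbitrary n×n complex matrix, and let t be a real number with 0 ≤ t ≤ 1. Then ‖A^{1−t}XB^t − A^tXB^{1−t}‖_F ≤ |1 − 2t| · ‖AX − XB‖_F, where ‖·‖_F denotes the Frobenius norm. (Corollary 2.6, instance for the Frobenius norm) -/
open scoped ComplexOrder

open Matrix

/-- `sinh` is convex on the nonnegative reals. -/
theorem convexOn_sinh_Ici : ConvexOn ℝ (Set.Ici 0) Real.sinh := by
  refine MonotoneOn.convexOn_of_deriv (convex_Ici 0) Real.continuous_sinh.continuousOn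
    Real.differentiable_sinh.differentiableOn ?_
  intro x hx y hy hxy
  rw [interior_Ici] at hx hy
  rw [Real.deriv_sinh, Real.cosh_le_cosh, abs_of_pos hx, abs_of_pos hy]
  exact hxy

theorem abs_sinh_mul_le {c : ℝ} (hc : |c| ≤ 1) (u : ℝ) :
    |Real.sinh (c * u)| ≤ |c| * |Real.sinh u| := by
  have h := convexOn_sinh_Ici.2 (x := 0) (y := |u|) Set.self_mem_Ici (abs_nonneg u)
    (sub_nonneg.2 hc) (abs_nonneg c) (sub_add_cancel 1 |c|)
  simpa [Real.abs_sinh, abs_mul] using h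

theorem exp_sub_exp_eq_mul_sinh (x y : ℝ) :
    Real.exp x - Real.exp y = 2 * Real.exp ((x + y) / 2) * Real.sinh ((x - y) / 2) := by
  have hx : x = (x + y) / 2 + (x - y) / 2 := by ring
  have hy : y = (x + y) / 2 + -((x - y) / 2) := by ring
  rw [Real.sinh_eq]
  have hex := congrArg Real.exp hx
  have hey := congrArg Real.exp hy
  rw [Real.exp_add] at hex hey
  rw [hex, hey]
  ring

/-- The scalar difference Heinz inequality. -/
theorem abs_heinz_sub_le {a b t : ℝ} (ha : 0 ≤ a) (hb : 0 ≤ b) (ht0 : 0 ≤ t) (ht1 : t ≤ 1) :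
    |a ^ (1 - t) * b ^ t - a ^ t * b ^ (1 - t)| ≤ |1 - 2 * t| * |a - b| := by
  rcases eq_or_lt_of_le ht0 with rfl | ht0
  · simp
  rcases eq_or_lt_of_le ht1 with rfl | ht1
  · norm_num [abs_sub_comm]
  have ht1' : 1 - t ≠ 0 := by linarith
  rcases eq_or_lt_of_le ha with rfl | ha
  · simp [Real.zero_rpow, ht0.ne', ht1']
    positivity
  rcases eq_or_lt_of_le hb with rfl | hb
  · simp [Real.zero_rpow, ht0.ne', ht1']
    positivity
  obtain ⟨x, rfl⟩ : ∃ x, Real.exp x = a := ⟨_, Real.exp_log ha⟩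
  obtain ⟨y, rfl⟩ : ∃ y, Real.exp y = b := ⟨_, Real.exp_log hb⟩
  simp only [← Real.exp_mul, ← Real.exp_add]
  rw [exp_sub_exp_eq_mul_sinh, exp_sub_exp_eq_mul_sinh x y,
    show (x * (1 - t) + y * t + (x * t + y * (1 - t))) / 2 = (x + y) / 2 by ring,
    show (x * (1 - t) + y * t - (x * t + y * (1 - t))) / 2 = (1 - 2 * t) * ((x - y) / 2) by ring,
    abs_mul _ (Real.sinh _), abs_mul _ (Real.sinh _), mul_left_comm]
  refine mul_le_mul_of_nonneg_left (abs_sinh_mul_le ?_ _) (abs_nonneg _)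
  rw [abs_le]
  constructor <;> linarith

theorem frobNorm_eq_sqrt_trace {n : ℕ} (M : Matrix (Fin n) (Fin n) ℂ) :
    frobNorm M = Real.sqrt (Mᴴ * M).trace.re := by
  unfold frobNorm
  congr 1
  rw [Finset.sum_comm]
  simp [Matrix.trace, Matrix.mul_apply, ← Complex.normSq_eq_norm_sq, Complex.normSq_apply]

/-- The Frobenius norm is unitarily invariant. -/
theorem frobNorm_unitary_mul_mul {n : ℕ} (U V : unitary (Matrix (Fin n) (Fin n) ℂ))
    (M : Matrix (Fin n) (Fin n) ℂ) :
    frobNorm (star (U : Matrix (Fin n) (Fin n) ℂ) * M * (V : Matrix (Fin n) (Fin n) ℂ)) =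
      frobNorm M := by
  have hU : (U : Matrix (Fin n) (Fin n) ℂ) * star (U : Matrix (Fin n) (Fin n) ℂ) = 1 :=
    Unitary.coe_mul_star_self U
  have hV : (V : Matrix (Fin n) (Fin n) ℂ) * star (V : Matrix (Fin n) (Fin n) ℂ) = 1 :=
    Unitary.coe_mul_star_self V
  rw [star_eq_conjTranspose] at hU hV
  rw [frobNorm_eq_sqrt_trace, frobNorm_eq_sqrt_trace, star_eq_conjTranspose]
  congr 2
  simp only [conjTranspose_mul, conjTranspose_conjTranspose]
  calc _ = ((V : Matrix (Fin n) (Fin n) ℂ)ᴴ *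
        (Mᴴ * ((U : Matrix (Fin n) (Fin n) ℂ) * (U : Matrix (Fin n) (Fin n) ℂ)ᴴ) * M * V)).trace := by
        simp only [mul_assoc]
    _ = _ := by rw [trace_mul_comm, hU, mul_one, mul_assoc, hV, mul_one]

theorem frobNorm_le_mul {n : ℕ} {M N : Matrix (Fin n) (Fin n) ℂ} {c : ℝ} (hc : 0 ≤ c)
    (h : ∀ i j, ‖M i j‖ ≤ c * ‖N i j‖) : frobNorm M ≤ c * frobNorm N := by
  unfold frobNorm
  rw [← Real.sqrt_sq hc, ← Real.sqrt_mul (sq_nonneg c), Finset.mul_sum]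
  refine Real.sqrt_le_sqrt (Finset.sum_le_sum fun i _ => ?_)
  rw [Finset.mul_sum]
  refine Finset.sum_le_sum fun j _ => ?_
  rw [← mul_pow]
  exact pow_le_pow_left₀ (norm_nonneg _) (h i j) 2

theorem mpow_eq_unitary_conj {n : ℕ} {A : Matrix (Fin n) (Fin n) ℂ} (hA : A.IsHermitian) (v : ℝ) :
    mpow A v = hA.eigenvectorUnitary *
      diagonal (fun i => ((hA.eigenvalues i ^ v : ℝ) : ℂ)) *
        star (hA.eigenvectorUnitary : Matrix (Fin n) (Fin n) ℂ) := by
  rw [mpow, hA.cfc_eq, Matrix.IsHermitian.cfc, Unitary.conjStarAlgAut_apply]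
  rfl

theorem mpow_zero_of_isHermitian {n : ℕ} {A : Matrix (Fin n) (Fin n) ℂ} (hA : A.IsHermitian) :
    mpow A 0 = 1 := by
  simp only [mpow, Real.rpow_zero]
  exact cfc_const_one ℝ A hA.isSelfAdjoint

theorem mpow_one_of_isHermitian {n : ℕ} {A : Matrix (Fin n) (Fin n) ℂ} (hA : A.IsHermitian) :
    mpow A 1 = A := by
  simp only [mpow, Real.rpow_one]
  exact cfc_id' ℝ A hA.isSelfAdjoint

/-- In eigenbases of `A` and `B`, the map `X ↦ A ^ r * X * B ^ s` acts as a Schur multiplier. -/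
theorem mpow_mul_mul_mpow_apply {n : ℕ} {A B : Matrix (Fin n) (Fin n) ℂ}
    (hA : A.IsHermitian) (hB : B.IsHermitian) (X : Matrix (Fin n) (Fin n) ℂ) (r s : ℝ)
    (i j : Fin n) :
    (star (hA.eigenvectorUnitary : Matrix (Fin n) (Fin n) ℂ) * (mpow A r * X * mpow B s) *
        hB.eigenvectorUnitary) i j =
      ((hA.eigenvalues i ^ r * hB.eigenvalues j ^ s : ℝ) : ℂ) *
        (star (hA.eigenvectorUnitary : Matrix (Fin n) (Fin n) ℂ) * X *
          hB.eigenvectorUnitary) i j := by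
  have hU : star (hA.eigenvectorUnitary : Matrix (Fin n) (Fin n) ℂ) *
      (hA.eigenvectorUnitary : Matrix (Fin n) (Fin n) ℂ) = 1 :=
    Unitary.coe_star_mul_self hA.eigenvectorUnitary
  have hV : star (hB.eigenvectorUnitary : Matrix (Fin n) (Fin n) ℂ) *
      (hB.eigenvectorUnitary : Matrix (Fin n) (Fin n) ℂ) = 1 :=
    Unitary.coe_star_mul_self hB.eigenvectorUnitary
  rw [mpow_eq_unitary_conj hA, mpow_eq_unitary_conj hB]
  generalize (hA.eigenvectorUnitary : Matrix (Fin n) (Fin n) ℂ) = U at *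
  generalize (hB.eigenvectorUnitary : Matrix (Fin n) (Fin n) ℂ) = V at *
  generalize hD : diagonal (fun i => ((hA.eigenvalues i ^ r : ℝ) : ℂ)) = D
  generalize hE : diagonal (fun i => ((hB.eigenvalues i ^ s : ℝ) : ℂ)) = E
  have h : star U * (U * D * star U * X * (V * E * star V)) * V = D * (star U * X * V) * E := by
    calc _ = (star U * U) * D * (star U * X * V) * E * (star V * V) := by simp only [mul_assoc]
      _ = _ := by rw [hU, hV, one_mul, mul_one]
  rw [h, ← hD, ← hE, mul_diagonal, diagonal_mul]
  push_cast
  ring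

/-- Corollary 2.6 for the Frobenius norm. -/
theorem heinz_diff_le_commutator_frobenius (n : ℕ) (A B X : Matrix (Fin n) (Fin n) ℂ)
    (hA : A.PosSemidef) (hB : B.PosSemidef) (t : ℝ) (ht0 : 0 ≤ t) (ht1 : t ≤ 1) :
    frobNorm (mpow A (1 - t) * X * mpow B t - mpow A t * X * mpow B (1 - t)) ≤
      |1 - 2 * t| * frobNorm (A * X - X * B) := by
  have hAX : A * X - X * B = mpow A 1 * X * mpow B 0 - mpow A 0 * X * mpow B 1 := by
    rw [mpow_one_of_isHermitian hA.1, mpow_one_of_isHermitian hB.1, mpow_zero_of_isHermitian hA.1, mpow_zero_of_isHermitian hB.1, mul_one, one_mul]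
  rw [hAX, ← frobNorm_unitary_mul_mul hA.1.eigenvectorUnitary hB.1.eigenvectorUnitary,
    ← frobNorm_unitary_mul_mul hA.1.eigenvectorUnitary hB.1.eigenvectorUnitary
      (mpow A 1 * X * mpow B 0 - mpow A 0 * X * mpow B 1)]
  refine frobNorm_le_mul (abs_nonneg _) fun i j => ?_
  simp only [mul_sub, sub_mul _ _ (hB.1.eigenvectorUnitary : Matrix (Fin n) (Fin n) ℂ),
    Matrix.sub_apply, mpow_mul_mul_mpow_apply hA.1 hB.1]
  rw [← sub_mul, ← sub_mul, norm_mul, norm_mul, ← Complex.ofReal_sub, ← Complex.ofReal_sub,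
    Complex.norm_real, Complex.norm_real, ← mul_assoc]
  refine mul_le_mul_of_nonneg_right ?_ (norm_nonneg _)
  simpa using abs_heinz_sub_le (hA.eigenvalues_nonneg i) (hB.eigenvalues_nonneg j) ht0 ht1
end

section
/- Let A be an n×n diagonal complex matrix with positive diagonal entries λ₁, …, λₙ, let X be an arbitrary n×n complex matrix, and let s, t be real numbers with 0 ≤ s < 1/2 and 0 ≤ t ≤ 1. Then A^{1−t}XA^t + A^tXA^{1−t} = Y ∘ (∫_s^{1−s} A^v X A^{1−v} dv), where ∘ denotes the Hadamard (entrywise) product and Y is the n×n matrix with entries y_{ij} = 2H_t(λᵢ,λⱼ)/((1−2s)L_s(λᵢ,λⱼ)). (Schur-multiplier decomposition from the proof of Theorem 2.3) -/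
/-- The Heinz mean `H_t(a,b) = (a^{1-t} b^t + a^t b^{1-t}) / 2`. -/
noncomputable def heinzMean (t a b : ℝ) : ℝ :=
  (a ^ (1 - t) * b ^ t + a ^ t * b ^ (1 - t)) / 2

/-- The generalized logarithmic mean `L_s(a,b) = (1/(1-2s)) ∫_s^{1-s} a^v b^{1-v} dv`. -/
noncomputable def genLogMean (s a b : ℝ) : ℝ :=
  (1 / (1 - 2 * s)) * ∫ v in s..(1 - s), a ^ v * b ^ (1 - v)

/-- The `v`-th power of the diagonal matrix with positive diagonal entries `λ₁, …, λₙ`: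
the diagonal matrix with entries `λᵢ^v`. -/
noncomputable def dpow {n : ℕ} (lam : Fin n → ℝ) (v : ℝ) : Matrix (Fin n) (Fin n) ℂ :=
  Matrix.diagonal fun i => ((lam i ^ v : ℝ) : ℂ)

theorem continuous_rpow_mul_rpow_one_sub {a b : ℝ} (ha : 0 < a) (hb : 0 < b) :
    Continuous fun v : ℝ => a ^ v * b ^ (1 - v) :=
  (Real.continuous_const_rpow ha.ne').mul
    ((Real.continuous_const_rpow hb.ne').comp (continuous_const.sub continuous_id))

theorem integral_rpow_mul_rpow_one_sub_pos {a b s : ℝ} (ha : 0 < a) (hb : 0 < b)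
    (hs : s < 1 / 2) : 0 < ∫ v in s..(1 - s), a ^ v * b ^ (1 - v) :=
  intervalIntegral.intervalIntegral_pos_of_pos
    ((continuous_rpow_mul_rpow_one_sub ha hb).intervalIntegrable _ _)
    (fun v => mul_pos (Real.rpow_pos_of_pos ha v) (Real.rpow_pos_of_pos hb (1 - v)))
    (by linarith)

theorem one_sub_two_mul_mul_genLogMean {s : ℝ} (hs : s < 1 / 2) (a b : ℝ) :
    (1 - 2 * s) * genLogMean s a b = ∫ v in s..(1 - s), a ^ v * b ^ (1 - v) := by
  have h : 1 - 2 * s ≠ 0 := by linarith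
  rw [genLogMean, ← mul_assoc, mul_one_div_cancel h, one_mul]

theorem dpow_mul_mul_dpow_apply {n : ℕ} (lam : Fin n → ℝ) (X : Matrix (Fin n) (Fin n) ℂ)
    (u v : ℝ) (i j : Fin n) :
    (dpow lam u * X * dpow lam v) i j = ((lam i ^ u * lam j ^ v : ℝ) : ℂ) * X i j := by
  simp only [dpow, Matrix.mul_diagonal, Matrix.diagonal_mul]
  push_cast
  ring

theorem integral_dpow_mul_mul_dpow_apply {n : ℕ} (lam : Fin n → ℝ)
    (X : Matrix (Fin n) (Fin n) ℂ) (s : ℝ) (i j : Fin n) :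
    ∫ v in s..(1 - s), (dpow lam v * X * dpow lam (1 - v)) i j =
      ((∫ v in s..(1 - s), lam i ^ v * lam j ^ (1 - v) : ℝ) : ℂ) * X i j := by
  simp_rw [dpow_mul_mul_dpow_apply]
  rw [intervalIntegral.integral_mul_const, intervalIntegral.integral_ofReal]

/-- Schur-multiplier decomposition from the proof of Theorem 2.3: for a diagonal matrix `A`
with positive diagonal entries `λ₁, …, λₙ`,
`A^{1-t} X A^t + A^t X A^{1-t} = Y ∘ (∫_s^{1-s} A^v X A^{1-v} dv)`, where
`Y` has entries `2 H_t(λᵢ,λⱼ) / ((1-2s) L_s(λᵢ,λⱼ))` and `∘` is the Hadamard product. -/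
theorem schur_multiplier_decomposition (n : ℕ) (lam : Fin n → ℝ) (hlam : ∀ i, 0 < lam i)
    (X : Matrix (Fin n) (Fin n) ℂ) (s t : ℝ)
    (hs0 : 0 ≤ s) (hs : s < 1 / 2) (ht0 : 0 ≤ t) (ht1 : t ≤ 1) :
    dpow lam (1 - t) * X * dpow lam t + dpow lam t * X * dpow lam (1 - t) =
      Matrix.hadamard
        (Matrix.of fun i j : Fin n =>
          ((2 * heinzMean t (lam i) (lam j) / ((1 - 2 * s) * genLogMean s (lam i) (lam j)) : ℝ) : ℂ))
        (Matrix.of fun i j : Fin n =>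
          ∫ v in s..(1 - s), (dpow lam v * X * dpow lam (1 - v)) i j) := by
  ext i j
  have hI := (integral_rpow_mul_rpow_one_sub_pos (hlam i) (hlam j) hs).ne'
  rw [Matrix.add_apply, Matrix.hadamard_apply, Matrix.of_apply, Matrix.of_apply,
    integral_dpow_mul_mul_dpow_apply, one_sub_two_mul_mul_genLogMean hs,
    dpow_mul_mul_dpow_apply, dpow_mul_mul_dpow_apply, ← mul_assoc, ← Complex.ofReal_mul,
    div_mul_cancel₀ _ hI, ← add_mul, ← Complex.ofReal_add, heinzMean,
    mul_div_cancel₀ _ (two_ne_zero' ℝ)]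
end
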